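/- Let O be a non-trivial m-ovoid of the Hermitian polar space H(2r,q²), r ≥ 2. Then m ≥ (−3 + √(9 + 4(q^{2r+1} + q² − 2)))/(2(q²−1)). -/

import Mathlib

noncomputable section

open scoped BigOperators

namespace PolarOvoids

/-- The kind of the polar space `P'_{r,e}`: the elliptic quadric `Q⁻(2r+1,q)` (`e = 2`),
the symplectic polar space `W(2r-1,q)` (`e = 1`), or the Hermitian polar space `H(2r,q)`
with `q` a square (`e = 3/2`). -/
inductive PolarKind : Type where
  | elliptic
  | symplectic
  | hermitian

/-- The parameter `e` of the polar space. -/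
def PolarKind.e : PolarKind → ℝ
  | .elliptic => 2
  | .symplectic => 1
  | .hermitian => 3 / 2

/-- The dimension `2r + 2e - 2` of the vector space underlying the ambient projective
space `PG(n,q)`, `n = 2r + 2e - 3`. -/
def PolarKind.vdim : PolarKind → ℕ → ℕ
  | .elliptic, r => 2 * r + 2
  | .symplectic, r => 2 * r
  | .hermitian, r => 2 * r + 1

/-- The orthogonal complement (polar image) of a subspace with respect to a
(reflexive) sesquilinear form `B`. -/
def sperp {F V : Type} [Field F] [AddCommGroup V] [Module F V] {σ : F →+* F}
    (B : V →ₗ[F] V →ₛₗ[σ] F) (W : Submodule F V) : Submodule F V where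
  carrier := {v | ∀ w ∈ W, B w v = 0}
  add_mem' := by
    intro a b ha hb w hw
    simp only [map_add, ha w hw, hb w hw, add_zero]
  zero_mem' := by
    intro w hw
    simp
  smul_mem' := by
    intro c v hv w hw
    simp only [map_smulₛₗ, hv w hw, smul_zero]

/-- The set of points of the projective space `PG(n,q)` lying in a projective subspace,
given as the corresponding linear subspace `W`. -/
def pts {F V : Type} [Field F] [AddCommGroup V] [Module F V] (W : Submodule F V) :
    Set (Projectivization F V) := {p | p.rep ∈ W}

/-- The total weight `μ(S) = ∑_{p ∈ S} μ(p)` of a set `S` of projective points under a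
weight function `μ` on the points. -/
def wsum {F V : Type} [Field F] [AddCommGroup V] [Module F V]
    (μ : Projectivization F V → ℕ) (S : Set (Projectivization F V)) : ℝ :=
  ∑ᶠ p ∈ S, (μ p : ℝ)

/-- The weight `μ(S) = |S ∩ O|` of a point set `S` with respect to the point set `O`. -/
def nwt {X : Type} (O S : Set X) : ℝ := ((S ∩ O).ncard : ℝ)

/-- The defining property of each kind of polar space, in terms of the companion
automorphism `σ`, the sesquilinear form `B` inducing the polarity, the point set `sing`
of the polar space and the predicate `ti` of total isotropy (resp. total singularity):
* symplectic: `B` is a non-degenerate alternating bilinear form;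
* Hermitian: `B` is a non-degenerate Hermitian form with respect to the involutory field
  automorphism `σ` (so the field order is a square `q` and `σ : x ↦ x^√q`);
* elliptic: `B` is the bilinear form associated to a non-singular quadratic form `Q`,
  of Witt index `r` (imposed by the rank axioms below). -/
def PolarKind.Spec {F : Type} [Field F] {N : ℕ} :
    (k : PolarKind) → (σ : F →+* F) →
    ((Fin N → F) →ₗ[F] (Fin N → F) →ₛₗ[σ] F) →
    Set (Projectivization F (Fin N → F)) →
    (Submodule F (Fin N → F) → Prop) → Prop
  | .symplectic, σ, B, sing, ti =>
      σ = RingHom.id F ∧ (∀ v, B v v = 0) ∧ sing = Set.univ ∧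
        ∀ W, ti W ↔ ∀ v ∈ W, ∀ w ∈ W, B v w = 0
  | .hermitian, σ, B, sing, ti =>
      σ ≠ RingHom.id F ∧ σ.comp σ = RingHom.id F ∧
        (∀ v w, B w v = σ (B v w)) ∧
        sing = {p | B p.rep p.rep = 0} ∧
        ∀ W, ti W ↔ ∀ v ∈ W, ∀ w ∈ W, B v w = 0
  | .elliptic, σ, B, sing, ti =>
      σ = RingHom.id F ∧
        ∃ Q : QuadraticForm F (Fin N → F),
          (∀ v w, QuadraticMap.polar (⇑Q) v w = B v w) ∧
          sing = {p | Q p.rep = 0} ∧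
          ∀ W, ti W ↔ ∀ v ∈ W, Q v = 0

/-- A finite classical polar space `P'_{r,e}` of rank `r` and kind `k` over the finite
field `F` (of order `q`), consisting of the totally isotropic (resp. totally singular)
subspaces with respect to the defining form.  Its ambient projective space is
`PG(2r + 2e - 3, q)`, whose points are the points of `Projectivization F (Fin (k.vdim r) → F)`
and whose `j`-dimensional projective subspaces correspond to the linear subspaces
`W : Submodule F (Fin (k.vdim r) → F)` with `Module.finrank F W = j + 1`.
The polarity `⊥` of the ambient projective space is induced by the non-degenerate
reflexive (sesquilinear) form `B`; the rank axioms state that the Witt index is `r`,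
i.e. generators have projective dimension `r - 1`. -/
structure PolarSpace (F : Type) [Field F] (r : ℕ) (k : PolarKind) where
  σ : F →+* F
  B : (Fin (k.vdim r) → F) →ₗ[F] (Fin (k.vdim r) → F) →ₛₗ[σ] F
  nondeg : ∀ v, (∀ w, B v w = 0) → v = 0
  sing : Set (Projectivization F (Fin (k.vdim r) → F))
  ti : Submodule F (Fin (k.vdim r) → F) → Prop
  spec : k.Spec σ B sing ti
  rank_exists : ∃ W, ti W ∧ Module.finrank F ↥W = r
  rank_le : ∀ W, ti W → Module.finrank F ↥W ≤ r

namespace PolarSpace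

variable {F : Type} [Field F] {r : ℕ} {k : PolarKind}

/-- The image `π^⊥` of a subspace `π` under the polarity of the ambient projective space. -/
def perp (P : PolarSpace F r k) (W : Submodule F (Fin (k.vdim r) → F)) :
    Submodule F (Fin (k.vdim r) → F) := sperp P.B W

/-- The image `p^⊥` of a point `p` under the polarity of the ambient projective space. -/
def pperp (P : PolarSpace F r k) (p : Projectivization F (Fin (k.vdim r) → F)) :
    Submodule F (Fin (k.vdim r) → F) := sperp P.B (Submodule.span F {p.rep})

/-- A generator: a maximal totally isotropic (totally singular) subspace, i.e. one of
projective dimension `r - 1`. -/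
def IsGenerator (P : PolarSpace F r k) (W : Submodule F (Fin (k.vdim r) → F)) : Prop :=
  P.ti W ∧ Module.finrank F ↥W = r

/-- An `m`-ovoid: a set `O` of points of the polar space such that every generator
contains exactly `m` points of `O`. -/
def IsMOvoid (P : PolarSpace F r k) (m : ℕ)
    (O : Set (Projectivization F (Fin (k.vdim r) → F))) : Prop :=
  O ⊆ P.sing ∧ ∀ W, P.IsGenerator W → (pts W ∩ O).ncard = m

/-- A non-trivial `m`-ovoid: an `m`-ovoid with `0 < m < θ_{r-1} = (q^r - 1)/(q - 1)`,
the number of points of a generator. -/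
def IsNontrivialMOvoid [Fintype F] (P : PolarSpace F r k) (m : ℕ)
    (O : Set (Projectivization F (Fin (k.vdim r) → F))) : Prop :=
  P.IsMOvoid m O ∧ 0 < m ∧ m < ∑ i ∈ Finset.range r, Fintype.card F ^ i

/-- A weighted `m`-ovoid: a function `μ` assigning a natural number to each point of the
ambient projective space, vanishing on points not in the polar space, such that
`μ(p^⊥) + q^{r+e-2}·μ(p) = m·(q^{r+e-2} + 1)` for every point `p` of `PG(n,q)`. -/
def IsWeightedMOvoid [Fintype F] (P : PolarSpace F r k) (m : ℕ)
    (μ : Projectivization F (Fin (k.vdim r) → F) → ℕ) : Prop :=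
  (∀ p, p ∉ P.sing → μ p = 0) ∧
  ∀ p, wsum μ (pts (P.pperp p)) +
      (Fintype.card F : ℝ) ^ ((r : ℝ) + k.e - 2) * (μ p : ℝ)
    = (m : ℝ) * ((Fintype.card F : ℝ) ^ ((r : ℝ) + k.e - 2) + 1)

end PolarSpace

section HermitianSpace

open Module Finset
open scoped Classical

variable {F V : Type} [Field F] {σ : F →+* F} {q r : ℕ}

/-- The elements of trace zero over the fixed field of an involution are the multiples of
`e - σ e` by fixed elements, for any `e` that is not fixed. -/
lemma trace_eq_zero_iff (hσ : ∀ c, σ (σ c) = c) {e : F} (he : σ e ≠ e) (s : F) :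
    s + σ s = 0 ↔ ∃ k, σ k = k ∧ k * (e - σ e) = s := by
  have hd : e - σ e ≠ 0 := sub_ne_zero.2 (Ne.symm he)
  constructor
  · intro h
    refine ⟨s / (e - σ e), ?_, by field_simp⟩
    have h1 : σ s = -s := by linear_combination h
    have h2 : σ (e - σ e) = -(e - σ e) := by rw [map_sub, hσ]; ring
    rw [map_div₀, h1, h2, neg_div_neg_eq]
  · rintro ⟨k, hk, rfl⟩
    rw [map_mul, map_sub, hσ, hk]
    ring

lemma exists_trace_eq (hσ : ∀ c, σ (σ c) = c) (hne : ∃ c, σ c ≠ c) {c : F} (hc : σ c = c) :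
    ∃ s, s + σ s = c := by
  obtain ⟨t, ht⟩ : ∃ t, t + σ t ≠ 0 := by
    by_contra! h
    obtain ⟨c, hc⟩ := hne
    have h1 := h 1
    have h2 := h c
    rw [map_one] at h1
    exact hc (by linear_combination h2 - c * h1)
  have h3 : σ (t + σ t) = t + σ t := by rw [map_add, hσ, add_comm]
  refine ⟨c / (t + σ t) * t, ?_⟩
  rw [map_mul, map_div₀, hc, h3]
  field_simp

/-- The fixed field of an involution of the field of order `q²` has order `q`. -/
lemma card_fixed [Fintype F] (hF : Fintype.card F = q ^ 2) (hσ : ∀ c, σ (σ c) = c)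
    (hne : ∃ c, σ c ≠ c) :
    #{c : F | σ c = c} = q := by
  obtain ⟨e, he⟩ := hne
  have hd : e - σ e ≠ 0 := sub_ne_zero.2 (Ne.symm he)
  have h : #((univ.filter fun c : F => σ c = c) ×ˢ univ.filter fun c : F => σ c = c) = #(univ : Finset F) := by
    refine card_bij' (fun p _ => p.1 + e * p.2)
      (fun s _ => (s - e * ((s - σ s) / (e - σ e)), (s - σ s) / (e - σ e))) ?_ ?_ ?_ ?_
    · simp
    · intro s _
      have h2 : σ ((s - σ s) / (e - σ e)) = (s - σ s) / (e - σ e) := by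
        rw [map_div₀, map_sub, map_sub, hσ, hσ, ← neg_div_neg_eq, neg_sub, neg_sub]
      simp only [mem_product, mem_filter, mem_univ, true_and]
      refine ⟨?_, h2⟩
      rw [map_sub, map_mul, h2]
      field_simp
      ring
    · rintro ⟨a, b⟩ hab
      simp only [mem_product, mem_filter, mem_univ, true_and] at hab
      have h3 : (a + e * b - σ (a + e * b)) / (e - σ e) = b := by
        rw [map_add, map_mul, hab.1, hab.2]
        field_simp
        ring
      simp only [h3, Prod.mk.injEq, and_true]
      ring
    · intro s _
      simp
  rw [card_product, card_univ, hF, ← sq] at h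
  exact Nat.pow_left_injective (n := 2) (by norm_num) h

variable [AddCommGroup V] [Module F V] {B : V →ₗ[F] V →ₛₗ[σ] F}

lemma mem_sperp {W : Submodule F V} {v : V} : v ∈ sperp B W ↔ ∀ w ∈ W, B w v = 0 :=
  Iff.rfl

/-- A subspace is totally isotropic if the form vanishes identically on it. -/
def TotIso (B : V →ₗ[F] V →ₛₗ[σ] F) (W : Submodule F V) : Prop :=
  ∀ v ∈ W, ∀ w ∈ W, B v w = 0

variable [Fintype F]

/-- A non-degenerate Hermitian form of Witt index `r` on a space of dimension `2r+1` over
the field of order `q²`. -/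
structure IsHermitianSpace (B : V →ₗ[F] V →ₛₗ[σ] F) (q r : ℕ) : Prop where
  card_field : Fintype.card F = q ^ 2
  involutive : ∀ c, σ (σ c) = c
  ne_id : ∃ c, σ c ≠ c
  symm : ∀ v w, B w v = σ (B v w)
  nondeg : ∀ v, (∀ w, B v w = 0) → v = 0
  finrank_eq : finrank F V = 2 * r + 1
  rank_exists : ∃ W, TotIso B W ∧ finrank F W = r
  rank_le : ∀ W, TotIso B W → finrank F W ≤ r

/-- The fibres of a nonzero linear functional followed by the trace. -/
lemma card_trace_fiber [Fintype V] (hF : Fintype.card F = q ^ 2) (hσ : ∀ c, σ (σ c) = c)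
    (hne : ∃ c, σ c ≠ c) {W : Submodule F V} (f : V →ₗ[F] F) {x : V} (hx : x ∈ W)
    (hfx : f x ≠ 0) {c : F} (hc : σ c = c) :
    q * #{w : V | w ∈ W ∧ c + (f w + σ (f w)) = 0} = #{w : V | w ∈ W} := by
  have hsurj : ∀ c, σ c = c → ∃ w ∈ W, f w + σ (f w) = c := by
    intro c hc
    obtain ⟨s, hs⟩ := exists_trace_eq hσ hne hc
    exact ⟨(s / f x) • x, W.smul_mem _ hx, by simpa [hfx] using hs⟩
  have hfib : ∀ d, σ d = d → #{w : V | w ∈ W ∧ f w + σ (f w) = d} =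
      #{w : V | w ∈ W ∧ f w + σ (f w) = 0} := by
    intro d hd
    obtain ⟨w₀, hw₀, rfl⟩ := hsurj d hd
    refine card_bij' (fun w _ => w - w₀) (fun w _ => w + w₀) ?_ ?_ ?_ ?_
    · intro w hw
      simp only [mem_filter, mem_univ, true_and] at hw ⊢
      refine ⟨W.sub_mem hw.1 hw₀, ?_⟩
      rw [map_sub, map_sub]
      linear_combination hw.2
    · intro w hw
      simp only [mem_filter, mem_univ, true_and] at hw ⊢
      refine ⟨W.add_mem hw.1 hw₀, ?_⟩
      rw [map_add, map_add]
      linear_combination hw.2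
    · simp
    · simp
  have hsum : #{w : V | w ∈ W} = ∑ d ∈ {d : F | σ d = d},
      #{w : V | w ∈ W ∧ f w + σ (f w) = d} := by
    rw [card_eq_sum_card_fiberwise (f := fun w => f w + σ (f w)) (t := {d : F | σ d = d})]
    · simp only [filter_filter]
    · intro w _
      simp [hσ, add_comm]
  rw [hsum, sum_congr rfl fun d hd => hfib d (by simpa using hd), sum_const, smul_eq_mul,
    card_fixed hF hσ hne, ← hfib (-c) (by rw [map_neg, hc])]
  simp only [eq_neg_iff_add_eq_zero, add_comm c]

namespace IsHermitianSpace

variable (H : IsHermitianSpace B q r)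
include H

lemma q_pos : 2 ≤ q := by
  have h1 := H.card_field
  have h2 : 1 < Fintype.card F := Fintype.one_lt_card
  by_contra! h
  interval_cases q <;> omega

lemma apply_eq_zero_comm {v w : V} : B v w = 0 ↔ B w v = 0 := by
  rw [H.symm v w, map_eq_zero_iff σ σ.injective]

lemma totIso_sup_span {W : Submodule F V} (hW : TotIso B W) {x : V} (hx : x ∈ sperp B W)
    (hxx : B x x = 0) : TotIso B (W ⊔ F ∙ x) := by
  have hx' : ∀ w ∈ W, B w x = 0 := hx
  intro v hv w hw
  obtain ⟨v₁, hv₁, v₂, hv₂, rfl⟩ := Submodule.mem_sup.1 hv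
  obtain ⟨w₁, hw₁, w₂, hw₂, rfl⟩ := Submodule.mem_sup.1 hw
  obtain ⟨c, rfl⟩ := Submodule.mem_span_singleton.1 hv₂
  obtain ⟨d, rfl⟩ := Submodule.mem_span_singleton.1 hw₂
  simp [hW v₁ hv₁ w₁ hw₁, hx' v₁ hv₁, H.apply_eq_zero_comm.1 (hx' w₁ hw₁), hxx]

variable [Fintype V]

lemma card_submodule (W : Submodule F V) : #{v : V | v ∈ W} = q ^ (2 * finrank F W) := by
  rw [pow_mul, ← H.card_field, ← Module.card_eq_pow_finrank (K := F) (V := W),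
    Fintype.card_subtype]

lemma card_space : Fintype.card V = q ^ (4 * r + 2) := by
  rw [Module.card_eq_pow_finrank (K := F), H.card_field, H.finrank_eq, ← pow_mul]
  ring_nf

lemma card_perp (W : Submodule F V) :
    #{v : V | v ∈ sperp B W} * q ^ (2 * finrank F W) = q ^ (4 * r + 2) := by
  have hinj : Function.Injective B.flip := by
    intro v w hvw
    rw [← sub_eq_zero]
    refine H.nondeg _ fun u => H.apply_eq_zero_comm.1 ?_
    have := LinearMap.congr_fun hvw u
    simpa [sub_eq_zero] using this
  have : Finite (Dual F V) :=
    Finite.of_injective (fun (f : Dual F V) (v : V) => f v) DFunLike.coe_injective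
  have : Fintype (Dual F V) := .ofFinite _
  have : Fintype W.dualAnnihilator := .ofFinite _
  have hfin : Fintype.card (Dual F V) = Fintype.card V := by
    rw [Module.card_eq_pow_finrank (K := F), Module.card_eq_pow_finrank (K := F) (V := V),
      Subspace.dual_finrank_eq]
  have hbij : Function.Bijective B.flip :=
    (Fintype.bijective_iff_injective_and_card _).2 ⟨hinj, hfin.symm⟩
  have hcard : #{v : V | v ∈ sperp B W} = Fintype.card W.dualAnnihilator := by
    rw [Fintype.card_subtype]
    refine card_bij (fun v _ => B.flip v) ?_ (fun v _ w _ h => hinj h) ?_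
    · intro v hv
      simpa [Submodule.mem_dualAnnihilator, mem_sperp] using hv
    · intro φ hφ
      obtain ⟨v, rfl⟩ := hbij.2 φ
      exact ⟨v, by simpa [Submodule.mem_dualAnnihilator, mem_sperp] using hφ, rfl⟩
  rw [hcard, Module.card_eq_pow_finrank (K := F), H.card_field, ← pow_mul, ← pow_add, ← mul_add,
    add_comm, Subspace.finrank_add_finrank_dualAnnihilator_eq, H.finrank_eq]
  ring_nf

/-- Among the vectors that are not orthogonal to a totally isotropic subspace, one in `q` is
isotropic. -/
lemma card_isotropic_compl_perp {W : Submodule F V} (hW : TotIso B W) :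
    q * #{v : V | v ∉ sperp B W ∧ B v v = 0} = #{v : V | v ∉ sperp B W} := by
  have hmem : ∀ y, ∀ w ∈ W, (y + w ∈ sperp B W ↔ y ∈ sperp B W) := by
    intro y w hw
    have : w ∈ sperp B W := fun u hu => hW u hu w hw
    exact Submodule.add_mem_iff_left _ this
  have key := sum_card_bipartiteAbove_eq_sum_card_bipartiteBelow
    (s := {v : V | v ∉ sperp B W}) (t := {w : V | w ∈ W})
    (fun y w => B (y + w) (y + w) = 0)
  have h1 : ∀ y ∈ ({v : V | v ∉ sperp B W} : Finset V),
      q * #(bipartiteAbove (fun y w => B (y + w) (y + w) = 0) {w : V | w ∈ W} y) =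
        #{w : V | w ∈ W} := by
    intro y hy
    obtain ⟨x, hx, hxy⟩ : ∃ x ∈ W, B x y ≠ 0 := by
      simpa [mem_sperp] using hy
    rw [← card_trace_fiber H.card_field H.involutive H.ne_id (B.flip y) hx hxy
      (H.symm y y).symm, bipartiteAbove, filter_filter]
    congr 2
    ext w
    simp only [mem_filter, mem_univ, true_and]
    refine and_congr_right fun hw => ?_
    simp only [map_add, LinearMap.add_apply, hW w hw w hw, LinearMap.flip_apply, ← H.symm w y]
    rw [add_zero, add_assoc, add_comm (B w y)]
  have h2 : ∀ w ∈ ({w : V | w ∈ W} : Finset V),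
      #(bipartiteBelow (fun y w => B (y + w) (y + w) = 0) {v : V | v ∉ sperp B W} w) =
        #{v : V | v ∉ sperp B W ∧ B v v = 0} := by
    intro w hw
    replace hw : w ∈ W := by simpa using hw
    refine card_bij' (fun y _ => y + w) (fun y _ => y - w) ?_ ?_ ?_ ?_
    · intro y hy
      simp only [bipartiteBelow, mem_filter, mem_univ, true_and] at hy ⊢
      rwa [hmem y w hw]
    · intro y hy
      simp only [bipartiteBelow, mem_filter, mem_univ, true_and] at hy ⊢
      rw [← hmem _ w hw, sub_add_cancel]
      exact hy
    · simp
    · simp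
  rw [sum_congr rfl h2, sum_const, smul_eq_mul] at key
  have h3 := congrArg (q * ·) key
  simp only [mul_sum] at h3
  rw [sum_congr rfl h1, sum_const, smul_eq_mul] at h3
  have hpos : 0 < #{w : V | w ∈ W} := card_pos.2 ⟨0, by simp⟩
  refine Nat.eq_of_mul_eq_mul_right hpos ?_
  rw [h3]
  ring

lemma card_isotropic_aux {W : Submodule F V} (hW : TotIso B W) {k : ℕ}
    (hk : finrank F W + k = r) :
    #{v : V | B v v = 0} + q ^ (2 * r + 2 * k + 1) =
      #{v : V | v ∈ sperp B W ∧ B v v = 0} + q ^ (4 * r + 1) := by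
  have hq : 0 < q := by have := H.q_pos; omega
  have h1 := H.card_isotropic_compl_perp hW
  have h2 : #{v : V | v ∈ sperp B W} = q ^ (2 * r + 2 * k + 2) := by
    refine Nat.eq_of_mul_eq_mul_right (pow_pos hq (2 * finrank F W)) ?_
    rw [H.card_perp, ← pow_add]
    congr 1
    omega
  have h3 := card_filter_add_card_filter_not (s := (univ : Finset V)) (fun v => v ∈ sperp B W)
  rw [h2, card_univ, H.card_space] at h3
  have h4 := card_filter_add_card_filter_not (s := ({v : V | B v v = 0} : Finset V))
    (fun v => v ∈ sperp B W)
  simp only [filter_filter, and_comm (a := B _ _ = 0)] at h4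
  refine Nat.eq_of_mul_eq_mul_left hq ?_
  rw [mul_add, mul_add, ← h4, mul_add, h1, ← pow_succ', ← pow_succ', add_assoc, ← h3]
  ring

/-- The number of isotropic vectors orthogonal to a totally isotropic subspace. -/
lemma card_isotropic_perp {W : Submodule F V} (hW : TotIso B W) {k : ℕ}
    (hk : finrank F W + k = r) :
    #{v : V | v ∈ sperp B W ∧ B v v = 0} + q ^ (2 * r + 1) =
      q ^ (2 * r) + q ^ (2 * r + 2 * k + 1) := by
  obtain ⟨G, hG, hGr⟩ := H.rank_exists
  have h1 := H.card_isotropic_aux hW hk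
  have h2 := H.card_isotropic_aux hG (k := 0) (by omega)
  have h3 : #{v : V | v ∈ sperp B G ∧ B v v = 0} = q ^ (2 * r) := by
    rw [← hGr, ← H.card_submodule G]
    congr 2
    ext v
    refine ⟨fun ⟨hv, hvv⟩ => ?_, fun hv => ⟨fun u hu => hG u hu v hv, hG v hv v hv⟩⟩
    by_contra hvG
    have h4 := H.rank_le _ (H.totIso_sup_span hG hv hvv)
    rw [Submodule.finrank_sup_span_singleton hvG] at h4
    omega
  rw [h3] at h2
  simp only [mul_zero, add_zero] at h2
  omega

/-- The generators through a subspace. -/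
def generatorsThrough (B : V →ₗ[F] V →ₛₗ[σ] F) (r : ℕ) (W : Submodule F V) :
    Finset (Submodule F V) :=
  have : Fintype (Submodule F V) := .ofFinite _
  {G | (TotIso B G ∧ finrank F G = r) ∧ W ≤ G}

omit H [Fintype F] in
lemma mem_generatorsThrough {W G : Submodule F V} :
    G ∈ generatorsThrough B r W ↔ (TotIso B G ∧ finrank F G = r) ∧ W ≤ G := by
  simp [generatorsThrough]

omit H [Fintype F] in
/-- Double counting of incident pairs of a vector of `S` and a generator through `W`. -/
lemma sum_card_generatorsThrough {S : Finset V} {a : ℕ}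
    (hS : ∀ G, TotIso B G → finrank F G = r → #{v ∈ S | v ∈ G} = a) (W : Submodule F V) :
    ∑ y ∈ S with y ∈ sperp B W ∧ y ∉ W, #(generatorsThrough B r (W ⊔ F ∙ y)) +
      #(generatorsThrough B r W) * #{v ∈ S | v ∈ W} = #(generatorsThrough B r W) * a := by
  have key := sum_card_bipartiteAbove_eq_sum_card_bipartiteBelow
    (s := {y ∈ S | y ∈ sperp B W ∧ y ∉ W}) (t := generatorsThrough B r W)
    (fun y G => y ∈ G)
  have h1 : ∀ y, bipartiteAbove (fun (y : V) G => y ∈ G) (generatorsThrough B r W) y =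
      generatorsThrough B r (W ⊔ F ∙ y) := by
    intro y
    ext G
    simp only [bipartiteAbove, mem_filter, mem_generatorsThrough, sup_le_iff,
      Submodule.span_singleton_le_iff_mem, and_assoc]
  have h2 : ∀ G ∈ generatorsThrough B r W,
      #(bipartiteBelow (fun (y : V) G => y ∈ G) {y ∈ S | y ∈ sperp B W ∧ y ∉ W} G) +
        #{v ∈ S | v ∈ W} = a := by
    intro G hG
    rw [mem_generatorsThrough] at hG
    obtain ⟨⟨hG, hGr⟩, hWG⟩ := hG
    rw [← hS G hG hGr, ← card_filter_add_card_filter_not (s := {v ∈ S | v ∈ G})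
      (fun v => v ∈ W), add_comm]
    simp only [bipartiteBelow, filter_filter]
    congr 2
    · ext v
      simp only [mem_filter]
      exact ⟨fun h => ⟨h.1, hWG h.2, h.2⟩, fun h => ⟨h.1, h.2.2⟩⟩
    · ext v
      simp only [mem_filter]
      exact ⟨fun h => ⟨h.1, h.2.2, h.2.1.2⟩,
        fun h => ⟨h.1, ⟨fun u hu => hG u (hWG hu) v h.2.1, h.2.2⟩, h.2.1⟩⟩
  simp only [h1] at key
  rw [key, ← smul_eq_mul, ← sum_const, ← sum_add_distrib, sum_congr rfl h2, sum_const,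
    smul_eq_mul]

/-- The number of generators through a totally isotropic subspace of codimension `k` in a
generator. -/
lemma card_generatorsThrough {W : Submodule F V} (hW : TotIso B W) {k : ℕ}
    (hk : finrank F W + k = r) :
    #(generatorsThrough B r W) = ∏ i ∈ range k, (q ^ (2 * i + 3) + 1) := by
  induction k generalizing W with
  | zero =>
    rw [range_zero, prod_empty, card_eq_one]
    refine ⟨W, ?_⟩
    ext G
    rw [mem_generatorsThrough, mem_singleton]
    constructor
    · rintro ⟨⟨-, hG⟩, hWG⟩
      exact (Submodule.eq_of_le_of_finrank_eq hWG (by omega)).symm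
    · rintro rfl
      exact ⟨⟨hW, by omega⟩, le_rfl⟩
  | succ k ih =>
    have hq := H.q_pos
    have h1 := sum_card_generatorsThrough (B := B) (r := r) (S := {v : V | B v v = 0})
      (a := q ^ (2 * r)) (fun G hG hGr => by
        rw [← hGr, ← H.card_submodule G, filter_filter]
        congr 2
        ext v
        exact ⟨fun h => h.2, fun h => ⟨hG v h v h, h⟩⟩) W
    have h2 : ∀ y ∈ ({v : V | B v v = 0} : Finset V).filter (fun y => y ∈ sperp B W ∧ y ∉ W),
        #(generatorsThrough B r (W ⊔ F ∙ y)) = ∏ i ∈ range k, (q ^ (2 * i + 3) + 1) := by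
      intro y hy
      simp only [mem_filter, mem_univ, true_and] at hy
      refine ih (H.totIso_sup_span hW hy.2.1 hy.1) ?_
      rw [Submodule.finrank_sup_span_singleton hy.2.2]
      omega
    have h3 : #{v ∈ ({v : V | B v v = 0} : Finset V) | v ∈ W} = q ^ (2 * finrank F W) := by
      rw [← H.card_submodule W, filter_filter]
      congr 2
      ext v
      exact ⟨fun h => h.2, fun h => ⟨hW v h v h, h⟩⟩
    have h4 : #(({v : V | B v v = 0} : Finset V).filter (fun y => y ∈ sperp B W ∧ y ∉ W)) +
        q ^ (2 * finrank F W) = #{v : V | v ∈ sperp B W ∧ B v v = 0} := by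
      rw [← h3, ← card_filter_add_card_filter_not
        (s := ({v : V | v ∈ sperp B W ∧ B v v = 0} : Finset V)) (fun v => v ∈ W), add_comm]
      simp only [filter_filter]
      congr 2
      · ext v
        simp only [mem_filter, mem_univ, true_and]
        exact ⟨fun h => ⟨⟨fun u hu => hW u hu v h.2, h.1⟩, h.2⟩, fun h => ⟨h.1.2, h.2⟩⟩
      · ext v
        simp only [mem_filter, mem_univ, true_and]
        tauto
    have h5 := H.card_isotropic_perp hW hk
    rw [sum_congr rfl h2, sum_const, smul_eq_mul, h3] at h1
    rw [← h4] at h5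
    rw [prod_range_succ]
    set N := #(({v : V | B v v = 0} : Finset V).filter (fun y => y ∈ sperp B W ∧ y ∉ W))
    set g := #(generatorsThrough B r W)
    set p := ∏ i ∈ range k, (q ^ (2 * i + 3) + 1)
    set j := finrank F W
    clear_value N g p j
    subst hk
    have hne : (q : ℤ) ^ (2 * j) * (q ^ (2 * k + 2) - 1) ≠ 0 := by
      have : (1 : ℤ) < (q : ℤ) ^ (2 * k + 2) := one_lt_pow₀ (by omega) (by omega)
      have : (0 : ℤ) < (q : ℤ) ^ (2 * j) := by positivity
      have : (q : ℤ) ^ (2 * k + 2) - 1 ≠ 0 := by omega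
      positivity
    zify at h1 h5 ⊢
    refine mul_left_cancel₀ hne ?_
    linear_combination -h1 + p * h5

/-- A set of isotropic vectors that meets all generators in `a` vectors meets
`W^⊥ \ W` in `(q^(2k+3) + 1)(a - |S ∩ W|)` vectors. -/
lemma card_perp_diff {S : Finset V} {a : ℕ} (hiso : ∀ v ∈ S, B v v = 0)
    (hS : ∀ G, TotIso B G → finrank F G = r → #{v ∈ S | v ∈ G} = a)
    {W : Submodule F V} (hW : TotIso B W) {k : ℕ} (hk : finrank F W + (k + 1) = r) :
    #{v ∈ S | v ∈ sperp B W ∧ v ∉ W} + (q ^ (2 * k + 3) + 1) * #{v ∈ S | v ∈ W} =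
      (q ^ (2 * k + 3) + 1) * a := by
  have h1 := sum_card_generatorsThrough hS W
  have h2 : ∀ y ∈ S.filter (fun y => y ∈ sperp B W ∧ y ∉ W),
      #(generatorsThrough B r (W ⊔ F ∙ y)) = ∏ i ∈ range k, (q ^ (2 * i + 3) + 1) := by
    intro y hy
    rw [mem_filter] at hy
    refine H.card_generatorsThrough (H.totIso_sup_span hW hy.2.1 (hiso y hy.1)) ?_
    rw [Submodule.finrank_sup_span_singleton hy.2.2]
    omega
  rw [sum_congr rfl h2, sum_const, smul_eq_mul, H.card_generatorsThrough hW hk,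
    prod_range_succ] at h1
  have hpos : 0 < ∏ i ∈ range k, (q ^ (2 * i + 3) + 1) := prod_pos fun i _ => by positivity
  refine Nat.eq_of_mul_eq_mul_left hpos ?_
  linarith

/-- Orthogonality relation for the characters `u ↦ ψ (B z u)`. -/
lemma sum_addChar (z : V) :
    ∑ u, AddChar.FiniteField.primitiveChar_to_Complex F (B z u) =
      if z = 0 then (q : ℂ) ^ (4 * r + 2) else 0 := by
  set ψ := AddChar.FiniteField.primitiveChar_to_Complex F with hψ
  split_ifs with hz
  · simp [hz, H.card_space]
  · obtain ⟨u₀, hu₀⟩ : ∃ u, B z u ≠ 0 := by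
      by_contra! h
      exact hz (H.nondeg z h)
    have hprim := AddChar.FiniteField.primitiveChar_to_Complex_isPrimitive F one_ne_zero
    rw [AddChar.mulShift_one] at hprim
    obtain ⟨c, hc⟩ := AddChar.ne_one_iff.1 hprim
    have h1 := AddChar.sum_eq_ite (ψ.compAddMonoidHom (B z).toAddMonoidHom)
    rw [if_neg] at h1
    · exact h1
    · refine AddChar.ne_zero_iff.2 ⟨σ (c / B z u₀) • u₀, ?_⟩
      simpa [H.involutive, hu₀] using hc

/-- The Fourier transform of a set of vectors closed under nonzero scalars, in terms of its
intersections with hyperplanes. -/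
lemma sum_addChar_cone {S : Finset V} (hsmul : ∀ v ∈ S, ∀ c : F, c ≠ 0 → c • v ∈ S) (u : V) :
    ∑ z ∈ S, AddChar.FiniteField.primitiveChar_to_Complex F (B z u) =
      (((q : ℝ) ^ 2 * #{z ∈ S | B z u = 0} - #S) / ((q : ℝ) ^ 2 - 1) : ℝ) := by
  set ψ := AddChar.FiniteField.primitiveChar_to_Complex F with hψ
  have hprim := AddChar.FiniteField.primitiveChar_to_Complex_isPrimitive F
  have hq := H.q_pos
  have h1 : ∀ t : F, t ≠ 0 → ∑ z ∈ S, ψ (t * B z u) = ∑ z ∈ S, ψ (B z u) := by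
    intro t ht
    refine sum_bij' (fun z _ => t • z) (fun z _ => t⁻¹ • z) (fun z hz => hsmul z hz t ht)
      (fun z hz => hsmul z hz _ (inv_ne_zero ht)) ?_ ?_ ?_
    · intro z _
      simp [smul_smul, ht]
    · intro z _
      simp [smul_smul, ht]
    · intro z _
      simp
  have h2 : ∑ t : F, ∑ z ∈ S, ψ (t * B z u) = (q : ℂ) ^ 2 * #{z ∈ S | B z u = 0} := by
    rw [sum_comm, sum_congr rfl fun z _ => AddChar.sum_mulShift (B z u) hprim, H.card_field]
    push_cast
    rw [← sum_filter, sum_const, nsmul_eq_mul, mul_comm]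
  have hcard : ((univ.erase (0 : F)).card : ℂ) = (q : ℂ) ^ 2 - 1 := by
    rw [card_erase_of_mem (mem_univ _), card_univ, H.card_field, Nat.cast_sub (by nlinarith)]
    push_cast
    rfl
  rw [← add_sum_erase _ _ (mem_univ (0 : F)),
    sum_congr rfl fun t ht => h1 t (ne_of_mem_erase ht), sum_const, nsmul_eq_mul, hcard] at h2
  simp only [zero_mul, AddChar.map_zero_eq_one, sum_const, nsmul_eq_mul, mul_one] at h2
  have hne : (q : ℂ) ^ 2 - 1 ≠ 0 := by
    rw [← hcard, Nat.cast_ne_zero]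
    exact card_ne_zero.2 ⟨1, by simp⟩
  push_cast
  rw [eq_div_iff hne]
  linear_combination h2

/-- The first three moments of the Fourier transform of a set closed under nonzero scalars. -/
lemma moments {S : Finset V} (hsmul : ∀ v ∈ S, ∀ c : F, c ≠ 0 → c • v ∈ S) (h0 : 0 ∉ S)
    {φ : V → ℝ}
    (hφ : ∀ u, ∑ z ∈ S, AddChar.FiniteField.primitiveChar_to_Complex F (B z u) = (φ u : ℂ)) :
    ∑ u, φ u = 0 ∧ ∑ u, φ u ^ 2 = (q : ℝ) ^ (4 * r + 2) * #S ∧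
      ∑ u, φ u ^ 3 = (q : ℝ) ^ (4 * r + 2) * ∑ x ∈ S, (#{y ∈ S | -(x + y) ∈ S} : ℝ) := by
  have hneg : ∀ v ∈ S, -v ∈ S := fun v hv => by
    simpa using hsmul v hv (-1) (neg_ne_zero.2 one_ne_zero)
  refine ⟨?_, ?_, ?_⟩ <;> rw [← Complex.ofReal_inj]
  · push_cast
    simp only [← hφ]
    rw [sum_comm]
    simp only [H.sum_addChar]
    rw [sum_ite_eq' S 0, if_neg h0]
  · push_cast
    have h : ∀ u, (φ u : ℂ) ^ 2 =
        ∑ x ∈ S, ∑ y ∈ S, AddChar.FiniteField.primitiveChar_to_Complex F (B (x + y) u) := by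
      intro u
      simp only [map_add, LinearMap.add_apply, AddChar.map_add_eq_mul, ← mul_sum, ← sum_mul, hφ]
      ring
    have h2 : ∀ x ∈ S, ∑ y ∈ S, (if x + y = 0 then (q : ℂ) ^ (4 * r + 2) else 0) =
        (q : ℂ) ^ (4 * r + 2) := by
      intro x hx
      simp only [add_eq_zero_iff_eq_neg', sum_ite_eq', if_pos (hneg x hx)]
    rw [sum_congr rfl fun u _ => h u, sum_comm, sum_congr rfl fun x _ => sum_comm]
    simp only [H.sum_addChar]
    rw [sum_congr rfl h2, sum_const, nsmul_eq_mul, mul_comm]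
  · push_cast
    have h : ∀ u, (φ u : ℂ) ^ 3 = ∑ x ∈ S, ∑ y ∈ S, ∑ z ∈ S,
        AddChar.FiniteField.primitiveChar_to_Complex F (B (x + y + z) u) := by
      intro u
      simp only [map_add, LinearMap.add_apply, AddChar.map_add_eq_mul, ← mul_sum, ← sum_mul, hφ]
      ring
    rw [sum_congr rfl fun u _ => h u, sum_comm, mul_sum]
    refine sum_congr rfl fun x _ => ?_
    rw [sum_comm, sum_congr rfl fun y _ => sum_comm]
    simp only [H.sum_addChar, add_eq_zero_iff_eq_neg', sum_ite_eq']
    rw [← sum_filter, sum_const, nsmul_eq_mul, mul_comm]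

omit [Fintype V] in
lemma card_add_mem {S : Finset V} (hsmul : ∀ v ∈ S, ∀ c : F, c ≠ 0 → c • v ∈ S) (h0 : 0 ∉ S)
    {x : V} (hx : x ∈ S) : q ^ 2 ≤ #{y ∈ S | -(x + y) ∈ S} + 2 := by
  have hx0 : x ≠ 0 := fun h => h0 (h ▸ hx)
  have h1 : #((univ.erase (0 : F)).erase (-1)) ≤ #{y ∈ S | -(x + y) ∈ S} := by
    refine card_le_card_of_injOn (fun t => t • x) ?_ ?_
    · intro t ht
      simp only [coe_erase, coe_univ, Set.mem_sdiff, Set.mem_univ, Set.mem_singleton_iff,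
        true_and] at ht
      simp only [coe_filter, Set.mem_ofPred_eq]
      refine ⟨hsmul x hx t ht.1, ?_⟩
      have : -(x + t • x) = (-(1 + t)) • x := by module
      rw [this]
      refine hsmul x hx _ fun h => ht.2 ?_
      linear_combination -h
    · intro t _ s _ hts
      exact smul_left_injective F hx0 hts
  rw [card_erase_of_mem (by simp), card_erase_of_mem (mem_univ _), card_univ, H.card_field] at h1
  omega

/-- The number of vectors of a cone `S` meeting every generator in `a` vectors. -/
lemma card_cone {S : Finset V} {a : ℕ} (hiso : ∀ v ∈ S, B v v = 0)
    (hS : ∀ G, TotIso B G → finrank F G = r → #{v ∈ S | v ∈ G} = a)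
    (h0 : 0 ∉ S) (hr : 1 ≤ r) : #S = (q ^ (2 * r + 1) + 1) * a := by
  have hbot : TotIso B (⊥ : Submodule F V) := by
    intro v hv w _
    rw [(Submodule.mem_bot F).1 hv, map_zero, LinearMap.zero_apply]
  obtain ⟨k, rfl⟩ : ∃ k, r = k + 1 := ⟨r - 1, by omega⟩
  have h := H.card_perp_diff hiso hS hbot (k := k) (by rw [finrank_bot, zero_add])
  have h1 : S.filter (fun v => v ∈ sperp B ⊥ ∧ v ∉ (⊥ : Submodule F V)) = S := by
    refine filter_true_of_mem fun v hv => ⟨?_, ?_⟩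
    · intro w hw
      rw [(Submodule.mem_bot F).1 hw, map_zero, LinearMap.zero_apply]
    · rw [Submodule.mem_bot]
      exact fun h => h0 (h ▸ hv)
  have h2 : S.filter (fun v => v ∈ (⊥ : Submodule F V)) = ∅ := by
    refine filter_false_of_mem fun v hv => ?_
    rw [Submodule.mem_bot]
    exact fun h => h0 (h ▸ hv)
  rw [h1, h2, card_empty, mul_zero, add_zero] at h
  exact h

lemma card_cone_perp {S : Finset V} {a : ℕ} (hiso : ∀ v ∈ S, B v v = 0)
    (hsmul : ∀ v ∈ S, ∀ c : F, c ≠ 0 → c • v ∈ S) (h0 : 0 ∉ S)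
    (hS : ∀ G, TotIso B G → finrank F G = r → #{v ∈ S | v ∈ G} = a)
    (hr : 2 ≤ r) {x : V} (hx : x ∈ S) :
    #{z ∈ S | B z x = 0} + q ^ (2 * r - 1) * (q ^ 2 - 1) = (q ^ (2 * r - 1) + 1) * a := by
  have hx0 : x ≠ 0 := fun h => h0 (h ▸ hx)
  obtain ⟨k, rfl⟩ : ∃ k, r = k + 2 := ⟨r - 2, by omega⟩
  have hperp : ∀ v, v ∈ sperp B (F ∙ x) ↔ B v x = 0 := by
    intro v
    rw [H.apply_eq_zero_comm]
    refine ⟨fun h => h x (Submodule.mem_span_singleton_self x), fun h w hw => ?_⟩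
    obtain ⟨c, rfl⟩ := Submodule.mem_span_singleton.1 hw
    simp [h]
  have hW : TotIso B (F ∙ x) := by
    intro v hv w hw
    obtain ⟨c, rfl⟩ := Submodule.mem_span_singleton.1 hv
    obtain ⟨d, rfl⟩ := Submodule.mem_span_singleton.1 hw
    simp [hiso x hx]
  have h := H.card_perp_diff hiso hS hW (k := k) (by rw [finrank_span_singleton hx0]; omega)
  have h1 : #(S.filter (fun v => v ∈ F ∙ x)) = q ^ 2 - 1 := by
    have h2 : S.filter (fun v => v ∈ F ∙ x) = ({v : V | v ∈ F ∙ x} : Finset V).erase 0 := by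
      ext v
      simp only [mem_filter, mem_erase, mem_univ, true_and]
      refine and_congr_left fun hv => ⟨fun hvS h => h0 (h ▸ hvS), fun hv0 => ?_⟩
      obtain ⟨c, rfl⟩ := Submodule.mem_span_singleton.1 hv
      exact hsmul x hx c fun hc => hv0 (by rw [hc, zero_smul])
    rw [h2, card_erase_of_mem (by simp), H.card_submodule, finrank_span_singleton hx0]
  have h3 := card_filter_add_card_filter_not (s := S.filter fun z => B z x = 0)
    (fun v => v ∈ F ∙ x)
  simp only [filter_filter] at h3
  have h4 : S.filter (fun z => B z x = 0 ∧ z ∈ F ∙ x) = S.filter (fun v => v ∈ F ∙ x) := by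
    refine filter_congr fun v _ => and_iff_right_of_imp fun hv => ?_
    exact hW v hv x (Submodule.mem_span_singleton_self x)
  simp only [hperp] at h
  rw [h4, h1] at h3
  rw [h1] at h
  have h5 : 2 * (k + 2) - 1 = 2 * k + 3 := by omega
  rw [h5, ← h3]
  linarith

/-- The lower bound for a cone of isotropic vectors that meets all generators in `a` vectors. -/
lemma le_of_card_inter_generator {S : Finset V} {a : ℕ} (hiso : ∀ v ∈ S, B v v = 0)
    (hsmul : ∀ v ∈ S, ∀ c : F, c ≠ 0 → c • v ∈ S) (h0 : 0 ∉ S)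
    (hS : ∀ G, TotIso B G → finrank F G = r → #{v ∈ S | v ∈ G} = a)
    (hr : 2 ≤ r) (ha : 0 < a) :
    (q : ℝ) ^ (2 * r + 1) + (q : ℝ) ^ 2 - 2 ≤ (a : ℝ) ^ 2 + 3 * a := by
  have hq := H.q_pos
  set T : ℝ := (q : ℝ) ^ (2 * r + 1) with hT
  have hTpos : 0 < T := by positivity
  have hN : (q : ℝ) ^ (4 * r + 2) = T ^ 2 := by rw [hT, ← pow_mul]; congr 1; ring
  set φ : V → ℝ := fun u => ((q : ℝ) ^ 2 * #{z ∈ S | B z u = 0} - #S) / ((q : ℝ) ^ 2 - 1)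
    with hφdef
  obtain ⟨m1, m2, m3⟩ := H.moments hsmul h0 (φ := φ) (H.sum_addChar_cone hsmul)
  have hk : (#S : ℝ) = a * (T + 1) := by
    rw [H.card_cone hiso hS h0 (by omega), hT]
    push_cast
    ring
  have hq1 : (q : ℝ) ^ 2 - 1 ≠ 0 := by
    have : (2 : ℝ) ≤ q := by exact_mod_cast hq
    nlinarith
  have hφ0 : φ 0 = a * (T + 1) := by
    simp only [hφdef, map_zero, filter_true]
    rw [div_eq_iff hq1, hk]
    ring
  have hφS : ∀ x ∈ S, φ x = a - T := by
    intro x hx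
    have h1 := H.card_cone_perp hiso hsmul h0 hS hr hx
    have h2 : T = (q : ℝ) ^ (2 * r - 1) * (q : ℝ) ^ 2 := by
      rw [hT, ← pow_add]
      congr 1
      omega
    zify [Nat.one_le_pow 2 q (by omega)] at h1
    have h3 : (#{z ∈ S | B z x = 0} : ℝ) + (q : ℝ) ^ (2 * r - 1) * ((q : ℝ) ^ 2 - 1) =
        ((q : ℝ) ^ (2 * r - 1) + 1) * a := by exact_mod_cast h1
    simp only [hφdef]
    rw [div_eq_iff hq1, hk, h2]
    linear_combination (q : ℝ) ^ 2 * h3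
  have hsplit : ∀ g : V → ℝ, ∑ u, g u = ∑ u ∈ S, g u + (g 0 + ∑ u ∈ Sᶜ.erase 0, g u) := by
    intro g
    rw [add_sum_erase _ _ (by simpa using h0), sum_add_sum_compl]
  have hcard : (#(Sᶜ.erase 0) : ℝ) = T ^ 2 - a * (T + 1) - 1 := by
    have h1 := hsplit fun _ => 1
    simp only [sum_const, nsmul_eq_mul, mul_one, card_univ, H.card_space] at h1
    push_cast at h1
    rw [hN, hk] at h1
    linarith
  rw [hN, hk] at m2
  rw [hN] at m3
  have hrest : ∀ u ∈ Sᶜ.erase 0, φ u = a := by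
    have h1 : ∑ u ∈ Sᶜ.erase 0, (φ u - a) ^ 2 = 0 := by
      have h2 := hsplit φ
      have h3 := hsplit fun u => φ u ^ 2
      rw [m1, sum_congr rfl hφS, hφ0, sum_const, nsmul_eq_mul, hk] at h2
      rw [m2, sum_congr rfl fun x hx => by rw [hφS x hx], hφ0, sum_const, nsmul_eq_mul, hk] at h3
      simp only [sub_sq, sum_add_distrib, sum_sub_distrib, ← sum_mul, ← mul_sum, sum_const,
        nsmul_eq_mul, hcard]
      linear_combination -h3 + 2 * (a : ℝ) * h2
    rw [sum_eq_zero_iff_of_nonneg fun _ _ => sq_nonneg _] at h1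
    intro u hu
    exact sub_eq_zero.1 (pow_eq_zero_iff two_ne_zero |>.1 (h1 u hu))
  have hS3 : ∑ u ∈ S, φ u ^ 3 = a * (T + 1) * (a - T) ^ 3 := by
    rw [sum_congr rfl fun x hx => by rw [hφS x hx], sum_const, nsmul_eq_mul, hk]
  have hrest3 : ∑ u ∈ Sᶜ.erase 0, φ u ^ 3 = (T ^ 2 - a * (T + 1) - 1) * (a : ℝ) ^ 3 := by
    rw [sum_congr rfl fun x hx => by rw [hrest x hx], sum_const, nsmul_eq_mul, hcard]
  have hcube := hsplit fun u => φ u ^ 3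
  rw [m3, hS3, hrest3, hφ0] at hcube
  have hlow : a * (T + 1) * ((q : ℝ) ^ 2 - 2) ≤ ∑ x ∈ S, (#{y ∈ S | -(x + y) ∈ S} : ℝ) := by
    rw [← hk, ← nsmul_eq_mul]
    refine card_nsmul_le_sum _ _ _ fun x hx => ?_
    have : ((q ^ 2 : ℕ) : ℝ) ≤ (#{y ∈ S | -(x + y) ∈ S} + 2 : ℕ) :=
      Nat.cast_le.2 (H.card_add_mem hsmul h0 hx)
    push_cast at this
    linarith
  have hpos : 0 < T ^ 2 * (a * (T + 1)) := by positivity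
  have h1 := mul_le_mul_of_nonneg_left hlow (sq_nonneg T)
  have h2 : T ^ 2 * (a * (T + 1)) * (T + (q : ℝ) ^ 2 - 2) ≤
      T ^ 2 * (a * (T + 1)) * ((a : ℝ) ^ 2 + 3 * a) := by
    linarith
  exact le_of_mul_le_mul_left h2 hpos

end IsHermitianSpace

/-- The nonzero vectors spanning the points of a set of projective points. -/
def cone [Fintype V] (O : Set (Projectivization F V)) : Finset V :=
  {v | ∃ hv : v ≠ 0, Projectivization.mk F v hv ∈ O}

omit [Fintype F] in
lemma mem_cone [Fintype V] {O : Set (Projectivization F V)} {v : V} :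
    v ∈ cone O ↔ ∃ hv : v ≠ 0, Projectivization.mk F v hv ∈ O := by
  simp [cone]

omit [Fintype F] in
lemma mk_smul_eq {v : V} (hv : v ≠ 0) {c : F} (hcv : c • v ≠ 0) :
    Projectivization.mk F (c • v) hcv = Projectivization.mk F v hv :=
  (Projectivization.mk_eq_mk_iff' F _ _ hcv hv).2 ⟨c, rfl⟩

omit [Fintype F] in
lemma smul_mem_cone [Fintype V] {O : Set (Projectivization F V)} {v : V} (hv : v ∈ cone O)
    {c : F} (hc : c ≠ 0) : c • v ∈ cone O := by
  obtain ⟨hv0, hvO⟩ := mem_cone.1 hv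
  refine mem_cone.2 ⟨smul_ne_zero hc hv0, ?_⟩
  rwa [mk_smul_eq hv0]

omit [Fintype F] in
lemma exists_smul_rep_eq {v : V} (hv : v ≠ 0) :
    ∃ c : F, c ≠ 0 ∧ c • (Projectivization.mk F v hv).rep = v := by
  obtain ⟨a, ha⟩ := Projectivization.exists_smul_eq_mk_rep F v hv
  exact ⟨(a⁻¹ : Fˣ), Units.ne_zero _, by rw [← ha, ← Units.smul_def, inv_smul_smul]⟩

/-- The number of vectors in the intersection of a cone with a subspace. -/
lemma card_cone_inter [Fintype V] (O : Set (Projectivization F V)) (W : Submodule F V) :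
    #{v ∈ cone O | v ∈ W} = (pts W ∩ O).ncard * (Fintype.card F - 1) := by
  have : Fintype (Projectivization F V) := .ofFinite _
  rw [Set.ncard_eq_toFinset_card', ← card_univ, ← card_erase_of_mem (mem_univ (0 : F)),
    ← card_product]
  symm
  refine card_bij (fun x _ => x.2 • x.1.rep) ?_ ?_ ?_
  · rintro ⟨p, c⟩ h
    simp only [mem_product, Set.mem_toFinset, mem_erase, mem_univ, and_true] at h
    refine mem_filter.2 ⟨smul_mem_cone (mem_cone.2 ⟨p.rep_nonzero, ?_⟩) h.2,
      W.smul_mem _ h.1.1⟩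
    rw [p.mk_rep]
    exact h.1.2
  · rintro ⟨p, c⟩ hp ⟨p', c'⟩ hp' h
    simp only [mem_product, mem_erase, mem_univ, and_true] at hp hp' h
    have h1 : p = p' := by
      rw [← p.mk_rep, ← p'.mk_rep,
        ← mk_smul_eq p.rep_nonzero (smul_ne_zero hp.2 p.rep_nonzero),
        ← mk_smul_eq p'.rep_nonzero (smul_ne_zero hp'.2 p'.rep_nonzero)]
      simp only [h]
    subst h1
    rw [smul_left_injective F p.rep_nonzero h]
  · intro v hv
    obtain ⟨hvS, hvW⟩ := mem_filter.1 hv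
    obtain ⟨hv0, hvO⟩ := mem_cone.1 hvS
    obtain ⟨c, hc, hcv⟩ := exists_smul_rep_eq (F := F) hv0
    refine ⟨(Projectivization.mk F v hv0, c), ?_, hcv⟩
    simp only [mem_product, Set.mem_toFinset, mem_erase, mem_univ, and_true]
    refine ⟨⟨?_, hvO⟩, hc⟩
    rw [← hcv] at hvW
    exact (W.smul_mem_iff hc).1 hvW

end HermitianSpace

lemma PolarSpace.isHermitianSpace {F : Type} [Field F] [Fintype F] {q r : ℕ}
    (hq : Fintype.card F = q ^ 2) (P : PolarSpace F r PolarKind.hermitian) :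
    IsHermitianSpace P.B q r := by
  obtain ⟨hne, hinv, hsymm, -, hti⟩ := P.spec
  obtain ⟨W, hW, hWr⟩ := P.rank_exists
  exact
    { card_field := hq
      involutive := RingHom.congr_fun hinv
      ne_id := by
        by_contra! h
        exact hne (RingHom.ext h)
      symm := hsymm
      nondeg := P.nondeg
      finrank_eq := Module.finrank_fin_fun F
      rank_exists := ⟨W, (hti W).1 hW, hWr⟩
      rank_le := fun W hW => P.rank_le W ((hti W).2 hW) }

/-- Theorem 4.3(3): if `O` is a non-trivial `m`-ovoid of the Hermitian
polar space `H(2r,q²)`, `r ≥ 2`, then `m ≥ (−3 + √(9 + 4(q^{2r+1} + q² − 2)))/(2(q²−1))`. -/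
theorem hermitian_ovoid_lower_bound
    {F : Type} [Field F] [Fintype F] {q r m : ℕ} (hq : Fintype.card F = q ^ 2)
    (hr : 2 ≤ r) (P : PolarSpace F r PolarKind.hermitian)
    (O : Set (Projectivization F (Fin (PolarKind.hermitian.vdim r) → F)))
    (hO : P.IsNontrivialMOvoid m O) :
    (m : ℝ) ≥ (-3 + Real.sqrt (9 + 4 * ((q : ℝ) ^ (2 * r + 1) + (q : ℝ) ^ 2 - 2)))
        / (2 * ((q : ℝ) ^ 2 - 1)) := by
  classical
  have H := P.isHermitianSpace hq
  obtain ⟨-, -, -, hsing, hti⟩ := P.spec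
  obtain ⟨⟨hOs, hOm⟩, hm, -⟩ := hO
  have hq2 := H.q_pos
  have hq1 : 0 < q ^ 2 - 1 := Nat.sub_pos_of_lt (Nat.one_lt_pow two_ne_zero hq2)
  have key := H.le_of_card_inter_generator (S := cone O) (a := m * (q ^ 2 - 1))
    (fun v hv => by
      obtain ⟨hv0, hvO⟩ := mem_cone.1 hv
      obtain ⟨c, -, hcv⟩ := exists_smul_rep_eq (F := F) hv0
      have h : P.B _ _ = 0 := hsing ▸ hOs hvO
      have h' : P.B (c • (Projectivization.mk F v hv0).rep)
          (c • (Projectivization.mk F v hv0).rep) = 0 := by simp [h]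
      rwa [hcv] at h')
    (fun v hv c hc => smul_mem_cone hv hc)
    (fun h => (mem_cone.1 h).1 rfl)
    (fun G hG hGr => by
      convert card_cone_inter O G
      · rw [hOm G ⟨(hti G).2 hG, hGr⟩]
      · exact hq.symm)
    hr (Nat.mul_pos hm hq1)
  rw [Nat.cast_mul, Nat.cast_sub (by omega)] at key
  push_cast at key
  have hpos : (0 : ℝ) < (q : ℝ) ^ 2 - 1 := by
    have : (2 : ℝ) ≤ q := by exact_mod_cast hq2
    nlinarith
  rw [ge_iff_le, div_le_iff₀ (by positivity), neg_add_le_iff_le_add, Real.sqrt_le_iff]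
  refine ⟨by positivity, ?_⟩
  nlinarith

end PolarOvoids
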